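/- arXiv:0803.2003 — 4 statements merged into one kernel-verified Lean document; each statement's English description precedes it below -/
import Mathlib

section
/- Let 𝒜 be a unital *-algebra over ℂ, let ω be a state on 𝒜, and let T ∈ 𝒜 be hermitian with ω(T) = 0 and Re ω(T²) > 0. Set a = √(Re ω(T²)) and b = Re ω(T³) / (2 · Re ω(T²)). Then there exists a state ψ on 𝒜 such that Re ψ(T) ≤ b − √(a² + b²). In particular, since √(a² + b²) > |b|, there is a state in which the expectation value of T is strictly negative. -/
/-- A state on a unital *-algebra `A` over `ℂ`: a `ℂ`-linear functional `ω`
with `ω 1 = 1` such that `ω (x* x)` is real and nonnegative for all `x`. -/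
def IsState {A : Type*} [Ring A] [Algebra ℂ A] [StarRing A] [StarModule ℂ A]
    (ω : A →ₗ[ℂ] ℂ) : Prop :=
  ω 1 = 1 ∧ ∀ x : A, (ω (star x * x)).im = 0 ∧ 0 ≤ (ω (star x * x)).re

/-- The functional `y ↦ N⁻¹ ω (x* y x)`, where `N = ω (x* x) > 0`, is a state whenever `ω` is. -/
theorem IsState.conj {A : Type*} [Ring A] [Algebra ℂ A] [StarRing A] [StarModule ℂ A]
    {ω : A →ₗ[ℂ] ℂ} (hω : IsState ω) {x : A} {N : ℝ} (hN : 0 < N)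
    (hx : ω (star x * x) = N) :
    IsState (((N⁻¹ : ℝ) : ℂ) • ω ∘ₗ LinearMap.mulLeft ℂ (star x) ∘ₗ LinearMap.mulRight ℂ x) := by
  refine ⟨?_, fun y => ?_⟩
  · have hN' : (N : ℂ) ≠ 0 := by exact_mod_cast hN.ne'
    simp [hx, hN']
  · obtain ⟨him, hre⟩ := hω.2 (y * x)
    have h : star x * (star y * y * x) = star (y * x) * (y * x) := by
      simp only [star_mul, mul_assoc]
    simp only [LinearMap.smul_apply, LinearMap.comp_apply, LinearMap.mulLeft_apply,
      LinearMap.mulRight_apply, h, smul_eq_mul, Complex.re_ofReal_mul, Complex.im_ofReal_mul, him,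
      mul_zero, true_and]
    positivity

theorem state_expectation_lower_bound
    {A : Type*} [Ring A] [Algebra ℂ A] [StarRing A] [StarModule ℂ A]
    (ω : A →ₗ[ℂ] ℂ) (hω : IsState ω) (T : A) (hT : star T = T)
    (hT0 : ω T = 0) (hpos : 0 < (ω (T ^ 2)).re)
    (a b : ℝ) (ha : a = Real.sqrt ((ω (T ^ 2)).re))
    (hb : b = (ω (T ^ 3)).re / (2 * (ω (T ^ 2)).re)) :
    ∃ ψ : A →ₗ[ℂ] ℂ, IsState ψ ∧ (ψ T).re ≤ b - Real.sqrt (a ^ 2 + b ^ 2) := by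
  obtain ⟨s, hs⟩ : ∃ s : ℝ, ω (T ^ 2) = s := by
    refine ⟨(ω (T ^ 2)).re, Complex.ext rfl ?_⟩
    simpa [hT, sq] using (hω.2 T).1
  rw [hs, Complex.ofReal_re] at hpos ha hb
  have hm : (ω (T ^ 3)).re = 2 * b * s := by rw [hb]; field_simp
  have ha2 : a ^ 2 = s := by rw [ha, Real.sq_sqrt hpos.le]
  rw [ha2]
  set l : ℝ := b - Real.sqrt (s + b ^ 2) with hl
  -- `l` is the lower eigenvalue of the compression of `T` to the span of `1` and `T`,
  -- with eigenvector `s + l T`.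
  have hl2 : l ^ 2 = 2 * b * l + s := by
    have := Real.sq_sqrt (show 0 ≤ s + b ^ 2 by positivity)
    rw [hl]; linear_combination this
  let x : A := (s : ℂ) • (1 : A) + (l : ℂ) • T
  have hstar : star x = x := by simp [x, hT]
  have hxx : ω (star x * x) = ((s ^ 2 + l ^ 2 * s : ℝ) : ℂ) := by
    have h : x * x = ((s : ℂ) ^ 2) • (1 : A) + (2 * s * l : ℂ) • T + ((l : ℂ) ^ 2) • T ^ 2 := by
      simp only [x, add_mul, mul_add, smul_mul_assoc, mul_smul_comm, one_mul, mul_one, sq]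
      module
    rw [hstar, h]
    simp [hω.1, hT0, hs]
  have hxTx : (ω (star x * (T * x))).re = 2 * s ^ 2 * l + l ^ 2 * (2 * b * s) := by
    have h : x * (T * x) = ((s ^ 2 : ℝ) : ℂ) • T + ((2 * s * l : ℝ) : ℂ) • T ^ 2
        + ((l ^ 2 : ℝ) : ℂ) • T ^ 3 := by
      simp only [x, add_mul, mul_add, smul_mul_assoc, mul_smul_comm, one_mul, mul_one,
        pow_succ', pow_zero]
      push_cast
      module
    rw [hstar, h]
    simp only [map_add, map_smul, hT0, hs, smul_eq_mul, Complex.add_re, Complex.re_ofReal_mul,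
      Complex.ofReal_re, Complex.zero_re, hm]
    ring
  have hN : 0 < s ^ 2 + l ^ 2 * s := by positivity
  refine ⟨_, hω.conj hN hxx, le_of_eq ?_⟩
  simp only [LinearMap.smul_apply, LinearMap.comp_apply, LinearMap.mulLeft_apply,
    LinearMap.mulRight_apply, smul_eq_mul, Complex.re_ofReal_mul, hxTx]
  rw [inv_mul_eq_iff_eq_mul₀ hN.ne']
  linear_combination (-s * l) * hl2
end

section
/- Let 𝒜 be a unital *-algebra over ℂ, let ω be a state on 𝒜, and let T ∈ 𝒜 be hermitian with ω(T) = 0 and Re ω(T²) > 0. Set a = √(Re ω(T²)) and b = Re ω(T³) / (2 · Re ω(T²)). Then there exists a state ψ on 𝒜 such that Re ψ(T) ≥ b + √(a² + b²). In particular, since √(a² + b²) > |b|, there is a state in which the expectation value of T is strictly positive. -/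
/-- The functional `y ↦ ω (x* y x) / ω (x* x)`, the vector state of `x` in the GNS picture of `ω`. -/
noncomputable def conjState {A : Type*} [Ring A] [Algebra ℂ A] [StarRing A]
    (ω : A →ₗ[ℂ] ℂ) (x : A) : A →ₗ[ℂ] ℂ :=
  ((ω (star x * x)).re⁻¹ : ℂ) • (ω ∘ₗ LinearMap.mulLeft ℂ (star x) ∘ₗ LinearMap.mulRight ℂ x)

lemma conjState_apply {A : Type*} [Ring A] [Algebra ℂ A] [StarRing A]
    (ω : A →ₗ[ℂ] ℂ) (x y : A) :
    conjState ω x y = ((ω (star x * x)).re⁻¹ : ℂ) * ω (star x * (y * x)) := rfl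

lemma IsState.conjState {A : Type*} [Ring A] [Algebra ℂ A] [StarRing A] [StarModule ℂ A]
    {ω : A →ₗ[ℂ] ℂ} (hω : IsState ω) {x : A} (hx : 0 < (ω (star x * x)).re) :
    IsState (conjState ω x) := by
  refine ⟨?_, fun y => ?_⟩
  · have hreal : ω (star x * x) = ((ω (star x * x)).re : ℂ) :=
      Complex.ext rfl (by simpa using (hω.2 x).1)
    rw [conjState_apply, one_mul]
    nth_rewrite 2 [hreal]
    exact inv_mul_cancel₀ (Complex.ofReal_ne_zero.2 hx.ne')
  · have hmul : star x * (star y * y * x) = star (y * x) * (y * x) := by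
      rw [star_mul]; noncomm_ring
    obtain ⟨him, hre⟩ := hω.2 (y * x)
    rw [conjState_apply, hmul, ← Complex.ofReal_inv, Complex.im_ofReal_mul,
      Complex.re_ofReal_mul, him, mul_zero]
    exact ⟨rfl, mul_nonneg (inv_nonneg.2 hx.le) hre⟩

/-- The maximum of `c ↦ 2 s (c + b) / (c² + s)` is attained at `c = √(s + b²) - b`. -/
lemma add_sqrt_eq_ratio {s : ℝ} (hs : 0 < s) (b : ℝ) :
    b + √(s + b ^ 2) =
      ((√(s + b ^ 2) - b) ^ 2 + s)⁻¹ * (2 * (√(s + b ^ 2) - b) * s + 2 * b * s) := by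
  have hr : √(s + b ^ 2) ^ 2 = s + b ^ 2 := Real.sq_sqrt (by positivity)
  set r := √(s + b ^ 2)
  have hden : (r - b) ^ 2 + s ≠ 0 := by positivity
  rw [eq_inv_mul_iff_mul_eq₀ hden]
  linear_combination (r - b) * hr

theorem state_expectation_upper_bound
    {A : Type*} [Ring A] [Algebra ℂ A] [StarRing A] [StarModule ℂ A]
    (ω : A →ₗ[ℂ] ℂ) (hω : IsState ω) (T : A) (hT : star T = T)
    (hT0 : ω T = 0) (hpos : 0 < (ω (T ^ 2)).re)
    (a b : ℝ) (ha : a = Real.sqrt ((ω (T ^ 2)).re))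
    (hb : b = (ω (T ^ 3)).re / (2 * (ω (T ^ 2)).re)) :
    ∃ ψ : A →ₗ[ℂ] ℂ, IsState ψ ∧ b + Real.sqrt (a ^ 2 + b ^ 2) ≤ (ψ T).re := by
  have ha2 : a ^ 2 = (ω (T ^ 2)).re := by rw [ha, Real.sq_sqrt hpos.le]
  have hT3 : (ω (T ^ 3)).re = 2 * b * (ω (T ^ 2)).re := by rw [hb]; field_simp
  rw [ha2]
  set s := (ω (T ^ 2)).re
  set c := √(s + b ^ 2) - b
  set x : A := (c : ℂ) • 1 + T with hxdef
  have hstar : star x = x := by simp [hxdef, hT]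
  have hsq : (ω (star x * x)).re = c ^ 2 + s := by
    have hexp : x * x = ((c ^ 2 : ℝ) : ℂ) • 1 + ((2 * c : ℝ) : ℂ) • T + T ^ 2 := by
      simp only [hxdef, add_mul, mul_add, smul_mul_assoc, mul_smul_comm, one_mul, mul_one, pow_two]
      push_cast
      module
    rw [hstar, hexp]
    simp only [map_add, map_smul, hω.1, hT0, smul_eq_mul, Complex.add_re, Complex.re_ofReal_mul,
      Complex.one_re, Complex.zero_re]
    ring
  have hcube : (ω (star x * (T * x))).re = 2 * c * s + 2 * b * s := by
    have hexp : x * (T * x) =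
        ((c ^ 2 : ℝ) : ℂ) • T + ((2 * c : ℝ) : ℂ) • T ^ 2 + T ^ 3 := by
      simp only [hxdef, add_mul, mul_add, smul_mul_assoc, mul_smul_comm, one_mul, mul_one, pow_succ,
        pow_zero, mul_assoc]
      push_cast
      module
    rw [hstar, hexp]
    simp only [map_add, map_smul, hT0, smul_eq_mul, Complex.add_re, Complex.re_ofReal_mul,
      Complex.zero_re, hT3]
    ring
  refine ⟨conjState ω x, hω.conjState (by rw [hsq]; positivity), ?_⟩
  rw [conjState_apply, ← Complex.ofReal_inv, Complex.re_ofReal_mul, hsq, hcube]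
  exact (add_sqrt_eq_ratio hpos b).le
end

section
/- Let R be a commutative ring, M an R-module, Q a quadratic form on M, and let D be an even natural number. Let e : Fin D → M be a family of pairwise orthogonal vectors, i.e., polar Q (e i) (e j) = 0 whenever i ≠ j, where polar Q (x)(y) = Q(x + y) − Q(x) − Q(y). In the Clifford algebra CliffordAlgebra Q, let ω = ι(e 0) · ι(e 1) · ⋯ · ι(e (D−1)) be the ordered product of the generators associated to the eᵢ, where ι : M → CliffordAlgebra Q is the canonical embedding. Then for every v in the R-linear span of {e 0, …, e (D−1)} one has ω · ι(v) = − ι(v) · ω. -/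
namespace List

variable {A : Type*} [Ring A]

/-- An element anticommuting with every entry of a list commutes with its product up to the sign
`(-1) ^ length`. -/
theorem prod_mul_of_forall_anticommute {l : List A} {a : A} (h : ∀ x ∈ l, x * a = -(a * x)) :
    l.prod * a = (-1 : ℤ) ^ l.length • (a * l.prod) := by
  induction l with
  | nil => simp
  | cons x l ih =>
    rw [forall_mem_cons] at h
    rw [prod_cons, mul_assoc, ih h.2, mul_smul_comm, ← mul_assoc, h.1, length_cons, pow_succ,
      mul_smul, neg_one_smul, neg_mul, mul_assoc]

/-- An entry of a list of pairwise anticommuting elements commutes with the product of the list up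
to the sign `(-1) ^ (length + 1)`. -/
theorem prod_mul_of_mem_of_pairwise_anticommute {l : List A} {a : A}
    (h : l.Pairwise fun x y => y * x = -(x * y)) (ha : a ∈ l) :
    l.prod * a = (-1 : ℤ) ^ (l.length + 1) • (a * l.prod) := by
  induction l with
  | nil => simp at ha
  | cons x l ih =>
    rw [pairwise_cons] at h
    rcases mem_cons.mp ha with rfl | hal
    · rw [prod_cons, mul_assoc, prod_mul_of_forall_anticommute h.1, mul_smul_comm, length_cons,
        pow_add _ _ 1, pow_succ, mul_assoc]
      simp
    · have hxa : x * a = -(a * x) := by rw [h.1 a hal, neg_neg]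
      rw [prod_cons, mul_assoc, ih h.2 hal, mul_smul_comm, ← mul_assoc, hxa, length_cons,
        pow_succ _ (l.length + 1), mul_smul, neg_one_smul, neg_mul, mul_assoc]

end List

theorem volume_element_anticommutes
    {R M : Type*} [CommRing R] [AddCommGroup M] [Module R M]
    (Q : QuadraticForm R M) (D : ℕ) (hD : Even D)
    (e : Fin D → M)
    (horth : ∀ i j : Fin D, i ≠ j → QuadraticMap.polar Q (e i) (e j) = 0)
    (ω : CliffordAlgebra Q)
    (hω : ω = (List.ofFn fun i : Fin D => CliffordAlgebra.ι Q (e i)).prod) :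
    ∀ v ∈ Submodule.span R (Set.range e),
      ω * CliffordAlgebra.ι Q v = - (CliffordAlgebra.ι Q v * ω) := by
  intro v hv
  induction hv using Submodule.span_induction with
  | mem x hx =>
    obtain ⟨i, rfl⟩ := hx
    have hpair : (List.ofFn fun i : Fin D => CliffordAlgebra.ι Q (e i)).Pairwise
        fun x y => y * x = -(x * y) := by
      refine List.pairwise_ofFn.mpr fun j k hjk => ?_
      rw [CliffordAlgebra.ι_mul_ι_comm, horth k j hjk.ne', map_zero, zero_sub]
    rw [hω, List.prod_mul_of_mem_of_pairwise_anticommute hpair (List.mem_ofFn.mpr ⟨i, rfl⟩),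
      List.length_ofFn, hD.add_one.neg_one_pow, neg_one_smul]
  | zero => simp
  | add x y _ _ hx hy => rw [map_add, mul_add, hx, hy, add_mul, neg_add]
  | smul r x _ hx => rw [map_smul, mul_smul_comm, hx, smul_mul_assoc, smul_neg]
end

section
/- Let 𝒜 be a unital *-algebra over ℂ, let ω be a state on 𝒜, and let T ∈ 𝒜 be hermitian with Re ω(T²) > (Re ω(T))². Then there exist states ψ₋ and ψ₊ on 𝒜 such that Re ψ₋(T) < Re ω(T) < Re ψ₊(T). -/
/-- The functional `x ↦ ω (b* x b) / ω (b* b)` is a state whenever `ω (b* b) > 0`. -/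
theorem IsState.exists_conj {A : Type*} [Ring A] [Algebra ℂ A] [StarRing A] [StarModule ℂ A]
    {ω : A →ₗ[ℂ] ℂ} (hω : IsState ω) (b : A) (hb : 0 < (ω (star b * b)).re) :
    ∃ ψ : A →ₗ[ℂ] ℂ, IsState ψ ∧
      ∀ x, (ψ x).re = (ω (star b * x * b)).re / (ω (star b * b)).re := by
  set N : ℝ := (ω (star b * b)).re
  have hωN : ω (star b * b) = (N : ℂ) := Complex.ext rfl (by simpa using (hω.2 b).1)
  have hN0 : (N : ℂ) ≠ 0 := by exact_mod_cast hb.ne'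
  let ψ : A →ₗ[ℂ] ℂ :=
    ((N⁻¹ : ℝ) : ℂ) • (ω ∘ₗ LinearMap.mulRight ℂ b ∘ₗ LinearMap.mulLeft ℂ (star b))
  have hψ : ∀ x, ψ x = ((N⁻¹ : ℝ) : ℂ) * ω (star b * x * b) := fun x => by simp [ψ]
  refine ⟨ψ, ⟨?_, fun x => ?_⟩, fun x => ?_⟩
  · rw [hψ, mul_one, hωN, Complex.ofReal_inv, inv_mul_cancel₀ hN0]
  · have hx : star b * (star x * x) * b = star (x * b) * (x * b) := by
      simp only [star_mul, mul_assoc]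
    obtain ⟨him, hre⟩ := hω.2 (x * b)
    rw [hψ, hx, Complex.im_ofReal_mul, Complex.re_ofReal_mul, him, mul_zero]
    exact ⟨rfl, mul_nonneg (inv_nonneg.2 hb.le) hre⟩
  · rw [hψ, Complex.re_ofReal_mul, inv_mul_eq_div]

/-- Conjugating a state by `1 + c S`, for `S` hermitian of zero mean and `c` real, gives a state
whose value at `S` is explicit in the second and third moments of `S`. -/
theorem IsState.exists_perturbation {A : Type*} [Ring A] [Algebra ℂ A] [StarRing A]
    [StarModule ℂ A] {ω : A →ₗ[ℂ] ℂ} (hω : IsState ω) {S : A} (hS : star S = S)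
    (hmean : (ω S).re = 0) (c : ℝ) :
    ∃ ψ : A →ₗ[ℂ] ℂ, IsState ψ ∧
      (ψ S).re = (c * (2 * (ω (S ^ 2)).re + c * (ω (S ^ 3)).re)) /
        (1 + c ^ 2 * (ω (S ^ 2)).re) := by
  have hv : 0 ≤ (ω (S ^ 2)).re := by simpa [hS, sq] using (hω.2 S).2
  set b : A := 1 + (c : ℂ) • S with hbdef
  have hb : star b = b := by simp [b, hS]
  have hbb : (ω (star b * b)).re = 1 + c ^ 2 * (ω (S ^ 2)).re := by
    have h : star b * b = 1 + ((2 * c : ℝ) : ℂ) • S + ((c ^ 2 : ℝ) : ℂ) • S ^ 2 := by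
      rw [hb, hbdef, sq S]
      push_cast
      simp only [add_mul, mul_add, smul_mul_assoc, mul_smul_comm, one_mul, mul_one]
      module
    rw [h, map_add, map_add, map_smul, map_smul, hω.1]
    simp only [Complex.add_re, smul_eq_mul, Complex.re_ofReal_mul, Complex.one_re, hmean]
    ring
  have hbSb : (ω (star b * S * b)).re =
      c * (2 * (ω (S ^ 2)).re + c * (ω (S ^ 3)).re) := by
    have h : star b * S * b =
        S + ((2 * c : ℝ) : ℂ) • S ^ 2 + ((c ^ 2 : ℝ) : ℂ) • S ^ 3 := by
      rw [hb, hbdef]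
      push_cast
      simp only [add_mul, mul_add, smul_mul_assoc, mul_smul_comm, one_mul, mul_one, ← sq,
        ← pow_succ]
      module
    rw [h, map_add, map_add, map_smul, map_smul]
    simp only [Complex.add_re, smul_eq_mul, Complex.re_ofReal_mul, hmean]
    ring
  obtain ⟨ψ, hψ, hval⟩ := hω.exists_conj b (by rw [hbb]; positivity)
  exact ⟨ψ, hψ, by rw [hval, hbb, hbSb]⟩

theorem positive_variance_expectation_not_extremal
    {A : Type*} [Ring A] [Algebra ℂ A] [StarRing A] [StarModule ℂ A]
    (ω : A →ₗ[ℂ] ℂ) (hω : IsState ω) (T : A) (hT : star T = T)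
    (hvar : ((ω T).re) ^ 2 < (ω (T ^ 2)).re) :
    ∃ ψminus ψplus : A →ₗ[ℂ] ℂ, IsState ψminus ∧ IsState ψplus ∧
      (ψminus T).re < (ω T).re ∧ (ω T).re < (ψplus T).re := by
  set m : ℝ := (ω T).re with hm
  set S : A := T - (m : ℂ) • 1 with hSdef
  have hS : star S = S := by simp [S, hT]
  have hcenter : ∀ ψ : A →ₗ[ℂ] ℂ, IsState ψ → (ψ S).re = (ψ T).re - m := fun ψ hψ => by
    simp [S, hψ.1]
  have hmean : (ω S).re = 0 := by rw [hcenter ω hω, ← hm, sub_self]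
  have hv : 0 < (ω (S ^ 2)).re := by
    have h : S ^ 2 = T ^ 2 - ((2 * m : ℝ) : ℂ) • T + ((m ^ 2 : ℝ) : ℂ) • 1 := by
      rw [hSdef, sq, sq]
      push_cast
      simp only [sub_mul, mul_sub, smul_mul_assoc, mul_smul_comm, one_mul, mul_one]
      module
    rw [h, map_add, map_sub, map_smul, map_smul, hω.1]
    simp only [Complex.add_re, Complex.sub_re, smul_eq_mul, Complex.re_ofReal_mul,
      Complex.one_re, ← hm]
    nlinarith
  set v := (ω (S ^ 2)).re
  set w := (ω (S ^ 3)).re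
  obtain ⟨c, hc, hcw⟩ : ∃ c : ℝ, 0 < c ∧ c * |w| < 2 * v := by
    refine ⟨v / (1 + |w|), by positivity, ?_⟩
    rw [div_mul_eq_mul_div, div_lt_iff₀ (by positivity)]
    nlinarith [abs_nonneg w, mul_nonneg hv.le (abs_nonneg w)]
  have hcw' : |c * w| < 2 * v := by rwa [abs_mul, abs_of_pos hc]
  obtain ⟨hlow, hupp⟩ := abs_lt.1 hcw'
  obtain ⟨ψminus, hminus, hminus_val⟩ := hω.exists_perturbation hS hmean (-c)
  obtain ⟨ψplus, hplus, hplus_val⟩ := hω.exists_perturbation hS hmean c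
  refine ⟨ψminus, ψplus, hminus, hplus, ?_, ?_⟩
  · rw [← sub_neg, ← hcenter ψminus hminus, hminus_val]
    exact div_neg_of_neg_of_pos (mul_neg_of_neg_of_pos (by linarith) (by linarith))
      (by positivity)
  · rw [← sub_pos, ← hcenter ψplus hplus, hplus_val]
    exact div_pos (mul_pos hc (by linarith)) (by positivity)
end
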